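/- Leave-one-out monotonicity: let b_1,…,b_m ∈ ℝ^n, A := Σ_{j=1}^m b_j b_jᵀ, and for a fixed i let A_i := A − b_i b_iᵀ; assume A_i (hence A) is positive definite. Then: (1) A − A_i ⪰ 0 and A_i⁻¹ − A⁻¹ ⪰ 0; (2) for every k ∈ ℕ, b_iᵀA_i^k b_i ≤ b_iᵀA^k b_i and b_iᵀA^{−k} b_i ≤ b_iᵀA_i^{−k} b_i; (3) for every k ∈ ℕ, tr(A_i^k) ≤ tr(A^k) and tr(A^{−k}) ≤ tr(A_i^{−k}); (4) A⁻¹b_i b_iᵀA⁻¹ ⪯ A_i⁻¹b_i b_iᵀA_i⁻¹. -/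

import Mathlib

open Matrix

lemma aux_quad {n : ℕ} (P : Matrix (Fin n) (Fin n) ℝ) (hP : P.PosSemidef) (k : ℕ)
    (x : Fin n → ℝ) : 0 ≤ x ⬝ᵥ (P ^ k) *ᵥ x := by
  have h := (hP.pow k).dotProduct_mulVec_nonneg x
  simpa using h

lemma aux_vv {n : ℕ} (v : Fin n → ℝ) : (vecMulVec v v).PosSemidef := by
  simpa using Matrix.posSemidef_vecMulVec_self_star v

lemma aux_vec {n : ℕ} (P Q : Matrix (Fin n) (Fin n) ℝ) (hP : P.PosSemidef) (s : ℝ) (hs : 0 ≤ s)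
    (e : ℕ) (x v : Fin n → ℝ) (hv : v = (P ^ e) *ᵥ x) (hQ : Q = P + s • vecMulVec v v) (k : ℕ) :
    ∀ j : ℕ, x ⬝ᵥ (P ^ (j + k)) *ᵥ x ≤ x ⬝ᵥ (P ^ j * Q ^ k) *ᵥ x := by
  induction k with
  | zero => intro j; simp
  | succ k ih =>
    intro j
    have h1 : P ^ j * Q ^ (k + 1) = P ^ (j + 1) * Q ^ k
        + s • vecMulVec ((P ^ j) *ᵥ v) (v ᵥ* (Q ^ k)) := by
      rw [pow_succ' Q, hQ, ← mul_assoc, mul_add, add_mul, ← hQ, pow_succ, mul_smul_comm,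
        smul_mul_assoc, mul_vecMulVec, vecMulVec_mul]
    have h2 : 0 ≤ x ⬝ᵥ (P ^ j) *ᵥ v := by
      rw [hv, mulVec_mulVec, ← pow_add]
      exact aux_quad P hP _ x
    have h3 : 0 ≤ (v ᵥ* (Q ^ k)) ⬝ᵥ x := by
      have ht : (P ^ e)ᵀ = P ^ e := by
        have := (hP.pow e).isHermitian.eq
        simpa [conjTranspose_eq_transpose_of_trivial] using this
      have hv' : v = x ᵥ* (P ^ e) := by rw [hv, ← vecMul_transpose, ht]
      rw [hv', vecMul_vecMul, ← dotProduct_mulVec]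
      exact (aux_quad P hP _ x).trans (ih e)
    have h4 := ih (j + 1)
    rw [h1, add_mulVec, dotProduct_add, smul_mulVec, dotProduct_smul, vecMulVec_mulVec]
    rw [show j + (k + 1) = j + 1 + k by ring]
    have h5 : 0 ≤ s • (x ⬝ᵥ (MulOpposite.op ((v ᵥ* (Q ^ k)) ⬝ᵥ x) • (P ^ j) *ᵥ v)) := by
      rw [op_smul_eq_smul, dotProduct_smul]
      simp only [smul_eq_mul]
      positivity
    linarith

lemma aux_tr {n : ℕ} (P Q : Matrix (Fin n) (Fin n) ℝ) (hP : P.PosSemidef) (s : ℝ) (hs : 0 ≤ s)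
    (v : Fin n → ℝ) (hQ : Q = P + s • vecMulVec v v) (k : ℕ) :
    ∀ j : ℕ, (P ^ (k + j)).trace ≤ (Q ^ k * P ^ j).trace := by
  induction k with
  | zero => intro j; simp
  | succ k ih =>
    intro j
    have h1 : Q ^ (k + 1) * P ^ j = Q ^ k * P ^ (j + 1)
        + s • vecMulVec ((Q ^ k) *ᵥ v) (v ᵥ* (P ^ j)) := by
      rw [pow_succ Q, mul_assoc]
      nth_rw 2 [hQ]
      rw [add_mul, mul_add, ← pow_succ', smul_mul_assoc,
        mul_smul_comm, vecMulVec_mul, mul_vecMulVec]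
    have h2 : 0 ≤ (vecMulVec ((Q ^ k) *ᵥ v) (v ᵥ* (P ^ j))).trace := by
      rw [trace_vecMulVec, dotProduct_comm, ← dotProduct_mulVec, mulVec_mulVec]
      exact (aux_quad P hP _ v).trans (aux_vec P Q hP s hs 0 v v (by simp) hQ k j)
    have h4 := ih (j + 1)
    rw [h1, trace_add, trace_smul, show k + 1 + j = k + (j + 1) by ring, smul_eq_mul]
    have := mul_nonneg hs h2
    linarith


/-- leave-one-out monotonicity.  Let `A = Σ_j b_j b_jᵀ` and
`A_i = A − b_i b_iᵀ`, with `A_i` (hence `A`) positive definite.  Then: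
(1) `A − A_i ⪰ 0` and `A_i⁻¹ − A⁻¹ ⪰ 0`;
(2) `b_iᵀA_i^k b_i ≤ b_iᵀA^k b_i` and `b_iᵀA^{−k} b_i ≤ b_iᵀA_i^{−k} b_i` for `k ∈ ℕ`;
(3) `tr(A_i^k) ≤ tr(A^k)` and `tr(A^{−k}) ≤ tr(A_i^{−k})` for `k ∈ ℕ`;
(4) `A⁻¹ b_i b_iᵀ A⁻¹ ⪯ A_i⁻¹ b_i b_iᵀ A_i⁻¹`. -/
theorem leave_one_out_monotonicity {n m : ℕ}
    (b : Fin m → Fin n → ℝ) (i : Fin m)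
    (A Ai : Matrix (Fin n) (Fin n) ℝ)
    (hA : A = ∑ j, Matrix.vecMulVec (b j) (b j))
    (hAi : Ai = A - Matrix.vecMulVec (b i) (b i))
    (hpd : Ai.PosDef) :
    (A - Ai).PosSemidef ∧ (Ai⁻¹ - A⁻¹).PosSemidef ∧
    (∀ k : ℕ, b i ⬝ᵥ (Ai ^ k).mulVec (b i) ≤ b i ⬝ᵥ (A ^ k).mulVec (b i) ∧
      b i ⬝ᵥ (A⁻¹ ^ k).mulVec (b i) ≤ b i ⬝ᵥ (Ai⁻¹ ^ k).mulVec (b i)) ∧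
    (∀ k : ℕ, (Ai ^ k).trace ≤ (A ^ k).trace ∧ (A⁻¹ ^ k).trace ≤ (Ai⁻¹ ^ k).trace) ∧
    (Ai⁻¹ * Matrix.vecMulVec (b i) (b i) * Ai⁻¹
      - A⁻¹ * Matrix.vecMulVec (b i) (b i) * A⁻¹).PosSemidef := by
  have hAe : A = Ai + (1 : ℝ) • vecMulVec (b i) (b i) := by rw [hAi, one_smul]; abel
  clear hA
  generalize b i = x at *
  have hApd : A.PosDef := by
    rw [hAe, one_smul]; exact hpd.add_posSemidef (aux_vv x)
  have hPpd := hApd.inv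
  have hQpd := hpd.inv
  have uA : IsUnit A.det := (isUnit_iff_isUnit_det A).1 hApd.isUnit
  have uB : IsUnit Ai.det := (isUnit_iff_isUnit_det Ai).1 hpd.isUnit
  have symm : ∀ M : Matrix (Fin n) (Fin n) ℝ, M.PosDef → x ᵥ* M = M *ᵥ x := by
    intro M hM
    have h := hM.isHermitian.eq
    rw [conjTranspose_eq_transpose_of_trivial] at h
    rw [← vecMul_transpose, h]
  obtain ⟨s, hs⟩ : ∃ s : ℝ, s = 1 + x ⬝ᵥ Ai⁻¹ *ᵥ x := ⟨_, rfl⟩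
  have hs1 : 1 ≤ s := by
    have := aux_quad Ai⁻¹ hQpd.posSemidef 1 x
    rw [pow_one] at this
    linarith
  obtain ⟨v, hv⟩ : ∃ v, v = A⁻¹ *ᵥ x := ⟨_, rfl⟩
  have hu : Ai⁻¹ *ᵥ x = s • v := by
    have h : A *ᵥ (Ai⁻¹ *ᵥ x) = s • x := by
      rw [hAe, one_smul, add_mulVec, mulVec_mulVec, mul_nonsing_inv _ uB, one_mulVec,
        vecMulVec_mulVec, op_smul_eq_smul, hs, add_smul, one_smul]
    rw [hv, ← mulVec_smul, ← h, mulVec_mulVec, nonsing_inv_mul _ uA, one_mulVec]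
  have hQ : Ai⁻¹ = A⁻¹ + s • vecMulVec v v := by
    have h : Ai⁻¹ * (A - Ai) * A⁻¹ = s • vecMulVec v v := by
      rw [hAe, one_smul, add_sub_cancel_left, ← one_smul ℝ (vecMulVec x x), ← hAe, one_smul,
        mul_vecMulVec, vecMulVec_mul, symm _ hPpd, hu, ← hv, smul_vecMulVec]
    rw [← h, mul_sub, sub_mul, nonsing_inv_mul _ uB, one_mul, mul_assoc, mul_nonsing_inv _ uA]
    simp
  have hs0 : 0 ≤ s := by linarith
  refine ⟨?_, ?_, fun k => ⟨?_, ?_⟩, fun k => ⟨?_, ?_⟩, ?_⟩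
  · rw [hAe, one_smul, add_sub_cancel_left]; exact aux_vv x
  · rw [hQ, add_sub_cancel_left]; exact (aux_vv v).smul hs0
  · simpa using aux_vec Ai A hpd.posSemidef 1 zero_le_one 0 x x (by simp) hAe k 0
  · simpa using aux_vec A⁻¹ Ai⁻¹ hPpd.posSemidef s hs0 1 x v (by simpa using hv) hQ k 0
  · simpa using aux_tr Ai A hpd.posSemidef 1 zero_le_one x hAe k 0
  · simpa using aux_tr A⁻¹ Ai⁻¹ hPpd.posSemidef s hs0 v hQ k 0
  · rw [mul_vecMulVec, vecMulVec_mul, mul_vecMulVec, vecMulVec_mul, symm _ hPpd, symm _ hQpd, hu,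
      ← hv, smul_vecMulVec, vecMulVec_smul]
    have : s • s • vecMulVec v v - vecMulVec v v = (s * s - 1) • vecMulVec v v := by
      rw [sub_smul, one_smul, mul_smul]
    first
    | rw [this]
    | rw [op_smul_eq_smul, this]
    exact (aux_vv v).smul (by nlinarith)
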